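/- arXiv:1301.2756 — 4 statements merged into one kernel-verified Lean document; each statement's English description precedes it below -/
import Mathlib

section
/- Let n ≥ 1 and let B be a 4×n complex matrix. There exist a matrix A ∈ SO⁺(1,3), vectors β, k ∈ ℂⁿ and a sign ε ∈ {1,-1} such that the rows of A·B are: first row √2·β, second row -√2·β, third row -k, fourth row ε·i·k, if and only if Bᵗ I_{1,3} B = 0. -/
open Matrix

/-- common kernel lemma, assuming the `a` entry of one matrix is nonzero -/
lemma nf_kernel_aux {ι : Type*} (a b c d : ι → ℂ)
    (h : ∀ i j, a i * d j + d i * a j - b i * c j - c i * b j = 0) (o : ι) (ho : a o ≠ 0) :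
    (∃ u v : ℂ, (u ≠ 0 ∨ v ≠ 0) ∧ ∀ j, u * a j + v * c j = 0 ∧ u * b j + v * d j = 0) ∨
    (∃ u v : ℂ, (u ≠ 0 ∨ v ≠ 0) ∧ ∀ j, u * a j + v * b j = 0 ∧ u * c j + v * d j = 0) := by
  by_cases hl : ∀ j, c o * a j + (-a o) * c j = 0
  · left
    refine ⟨c o, -a o, Or.inr (neg_ne_zero.mpr ho), fun j => ⟨hl j, ?_⟩⟩
    apply mul_left_cancel₀ ho
    linear_combination (-a o) * h o j + a j * h o o / 2 + b o * hl j
  · right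
    push Not at hl
    obtain ⟨i, hi⟩ := hl
    have key : ∀ k j, (c o * a k + (-a o) * c k) * (b o * a j + (-a o) * b j) +
        (c o * a j + (-a o) * c j) * (b o * a k + (-a o) * b k) = 0 := by
      intro k j
      linear_combination (-a o * a o) * h k j + a o * a j * h o k + a o * a k * h o j
        - a j * a k * h o o
    have hi2 : b o * a i + (-a o) * b i = 0 := by
      have := key i i
      rcases mul_eq_zero.mp (show (c o * a i + (-a o) * c i) * (b o * a i + (-a o) * b i) = 0 by
        linear_combination this / 2) with h1 | h1
      · exact absurd h1 hi
      · exact h1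
    have hr : ∀ j, b o * a j + (-a o) * b j = 0 := by
      intro j
      have := key i j
      rw [hi2, mul_zero, add_zero] at this
      exact (mul_eq_zero.mp this).resolve_left hi
    refine ⟨b o, -a o, Or.inr (neg_ne_zero.mpr ho), fun j => ⟨hr j, ?_⟩⟩
    apply mul_left_cancel₀ ho
    linear_combination (-a o) * h o j + a j * h o o / 2 + c o * hr j

lemma nf_kernel {ι : Type*} (a b c d : ι → ℂ)
    (h : ∀ i j, a i * d j + d i * a j - b i * c j - c i * b j = 0) :
    (∃ u v : ℂ, (u ≠ 0 ∨ v ≠ 0) ∧ ∀ j, u * a j + v * c j = 0 ∧ u * b j + v * d j = 0) ∨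
    (∃ u v : ℂ, (u ≠ 0 ∨ v ≠ 0) ∧ ∀ j, u * a j + v * b j = 0 ∧ u * c j + v * d j = 0) := by
  by_cases ha : ∃ o, a o ≠ 0
  · obtain ⟨o, ho⟩ := ha
    exact nf_kernel_aux a b c d h o ho
  by_cases hb : ∃ o, b o ≠ 0
  · obtain ⟨o, ho⟩ := hb
    rcases nf_kernel_aux b a d c (fun i j => by linear_combination -h i j) o ho with
      ⟨u, v, h0, hh⟩ | ⟨u, v, h0, hh⟩
    · exact Or.inl ⟨u, v, h0, fun j => ⟨(hh j).2, (hh j).1⟩⟩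
    · exact Or.inr ⟨v, u, h0.symm, fun j => ⟨by linear_combination (hh j).1,
        by linear_combination (hh j).2⟩⟩
  push Not at ha hb
  left
  exact ⟨1, 0, Or.inl one_ne_zero, fun j => by simp [ha j, hb j]⟩

/-- the rotation attached to the unit quaternion `(p, q, r, s)` -/
def nfRot (p q r s : ℝ) : Matrix (Fin 4) (Fin 4) ℝ :=
  !![1, 0, 0, 0;
     0, p^2+q^2-r^2-s^2, 2*(p*r+q*s), 2*(q*r-p*s);
     0, -2*(p*r-q*s), p^2-q^2-r^2+s^2, 2*(p*q+r*s);
     0, 2*(p*s+q*r), -2*(p*q-r*s), p^2-q^2+r^2-s^2]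

lemma nfRot_orth (p q r s : ℝ) (h : p^2+q^2+r^2+s^2 = 1) :
    (nfRot p q r s)ᵀ * Matrix.diagonal ![(-1 : ℝ), 1, 1, 1] * nfRot p q r s
      = Matrix.diagonal ![(-1 : ℝ), 1, 1, 1] := by
  ext i j
  fin_cases i <;> fin_cases j <;>
    simp [nfRot, Matrix.mul_apply, Fin.sum_univ_four, Matrix.diagonal_apply] <;>
    first
    | ring1
    | linear_combination (p^2+q^2+r^2+s^2+1) * h

lemma nfRot_det (p q r s : ℝ) (h : p^2+q^2+r^2+s^2 = 1) : (nfRot p q r s).det = 1 := by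
  simp [nfRot, Matrix.det_succ_row_zero, Fin.sum_univ_succ, Fin.succAbove]
  linear_combination ((p^2+q^2+r^2+s^2)^2 + (p^2+q^2+r^2+s^2) + 1) * h

lemma nf_normalize (u v : ℂ) (h : u ≠ 0 ∨ v ≠ 0) : ∃ (m : ℂ) (p q r s : ℝ),
    p^2+q^2+r^2+s^2 = 1 ∧ m * u = p + q * Complex.I ∧ m * v = r + s * Complex.I := by
  have hpos : 0 < Complex.normSq u + Complex.normSq v := by
    rcases h with h | h
    · linarith [Complex.normSq_pos.mpr h, Complex.normSq_nonneg v]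
    · linarith [Complex.normSq_pos.mpr h, Complex.normSq_nonneg u]
  set N := Real.sqrt (Complex.normSq u + Complex.normSq v) with hN
  have hN0 : 0 < N := Real.sqrt_pos.mpr hpos
  have hN2 : N ^ 2 = Complex.normSq u + Complex.normSq v := Real.sq_sqrt hpos.le
  rw [Complex.normSq_apply, Complex.normSq_apply] at hN2
  refine ⟨((N⁻¹ : ℝ) : ℂ), N⁻¹ * u.re, N⁻¹ * u.im, N⁻¹ * v.re, N⁻¹ * v.im, ?_, ?_, ?_⟩
  · field_simp
    linarith
  · apply Complex.ext <;> simp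
  · apply Complex.ext <;> simp

/-- Let `B` be a `4×n` complex matrix.  There exist
`A ∈ SO⁺(1,3)`, vectors `β, k ∈ ℂⁿ` and a sign `ε ∈ {1,-1}` such that the rows
of `A·B` are `√2·β`, `-√2·β`, `-k`, `ε·i·k`, if and only if `Bᵗ I₁,₃ B = 0`. -/
theorem normal_form_iff_isotropic (n : ℕ) (hn : 1 ≤ n)
    (B : Matrix (Fin 4) (Fin n) ℂ) :
    (∃ (A : Matrix (Fin 4) (Fin 4) ℝ) (β k : Fin n → ℂ) (ε : ℂ),
        (ε = 1 ∨ ε = -1) ∧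
        Aᵀ * Matrix.diagonal ![(-1 : ℝ), 1, 1, 1] * A
            = Matrix.diagonal ![(-1 : ℝ), 1, 1, 1] ∧
        A.det = 1 ∧ 0 < A 0 0 ∧
        A.map (Complex.ofReal) * B
            = Matrix.of
                ![fun j => (Real.sqrt 2 : ℂ) * β j,
                  fun j => -(Real.sqrt 2 : ℂ) * β j,
                  fun j => -k j,
                  fun j => ε * Complex.I * k j]) ↔
      Bᵀ * Matrix.diagonal ![(-1 : ℂ), 1, 1, 1] * B = 0 := by
  have hs : (Real.sqrt 2 : ℂ) ≠ 0 := by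
    exact_mod_cast (Real.sqrt_pos.mpr (by norm_num : (0:ℝ) < 2)).ne'
  have hI : Complex.I ^ 2 = -1 := Complex.I_sq
  constructor
  · rintro ⟨A, β, k, ε, hε, hA, -, -, hAB⟩
    have hA' : (A.map Complex.ofReal)ᵀ * Matrix.diagonal ![(-1 : ℂ), 1, 1, 1] * A.map Complex.ofReal
        = Matrix.diagonal ![(-1 : ℂ), 1, 1, 1] := by
      have hD : (Matrix.diagonal ![(-1 : ℝ), 1, 1, 1]).map Complex.ofReal
          = Matrix.diagonal ![(-1 : ℂ), 1, 1, 1] := by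
        ext i j
        fin_cases i <;> fin_cases j <;> simp [Matrix.diagonal_apply]
      have := congrArg (fun M => M.map Complex.ofRealHom) hA
      simp only [Matrix.map_mul] at this
      rw [← hD]
      exact this
    have e : Bᵀ * Matrix.diagonal ![(-1 : ℂ), 1, 1, 1] * B =
        (A.map Complex.ofReal * B)ᵀ * Matrix.diagonal ![(-1 : ℂ), 1, 1, 1] *
          (A.map Complex.ofReal * B) := by
      conv_lhs => rw [← hA']
      rw [Matrix.transpose_mul]
      simp only [Matrix.mul_assoc]
    rw [e, hAB]
    have hε2 : ε ^ 2 = 1 := by rcases hε with h | h <;> simp [h]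
    ext i j
    simp [Matrix.mul_apply, Fin.sum_univ_four, Matrix.diagonal_apply]
    linear_combination k i * k j * ε ^ 2 * hI - k i * k j * hε2
  · intro hB
    have hB' : ∀ i j, -(B 0 i * B 0 j) + B 1 i * B 1 j + B 2 i * B 2 j + B 3 i * B 3 j = 0 := by
      intro i j
      have := congrFun (congrFun hB i) j
      simp [Matrix.mul_apply, Fin.sum_univ_four, Matrix.diagonal_apply] at this
      linear_combination this
    rcases nf_kernel (fun j => B 0 j + B 1 j) (fun j => B 2 j - Complex.I * B 3 j)
      (fun j => B 2 j + Complex.I * B 3 j) (fun j => B 0 j - B 1 j)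
      (fun i j => by linear_combination -2 * hB' i j + 2 * B 3 i * B 3 j * hI) with
      ⟨u, v, h0, hh⟩ | ⟨u, v, h0, hh⟩
    · obtain ⟨m, p, q, r, s, hn1, hu, hv⟩ := nf_normalize u v h0
      have hc : (p:ℂ)^2+q^2+r^2+s^2 = 1 := by exact_mod_cast hn1
      have h1 : ∀ j, (p + q * Complex.I) * (B 0 j + B 1 j) +
          (r + s * Complex.I) * (B 2 j + Complex.I * B 3 j) = 0 := fun j => by
        rw [← hu, ← hv]; linear_combination m * (hh j).1
      have h2 : ∀ j, (p + q * Complex.I) * (B 2 j - Complex.I * B 3 j) +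
          (r + s * Complex.I) * (B 0 j - B 1 j) = 0 := fun j => by
        rw [← hu, ← hv]; linear_combination m * (hh j).2
      refine ⟨nfRot p q r s, fun j => B 0 j / (Real.sqrt 2 : ℂ),
        fun j => -((nfRot p q r s).map Complex.ofReal * B) 2 j, 1, Or.inl rfl,
        nfRot_orth p q r s hn1, nfRot_det p q r s hn1, by simp [nfRot], ?_⟩
      ext i j
      fin_cases i <;> simp [nfRot, Matrix.mul_apply, Fin.sum_univ_four]
      · field_simp
      · rw [mul_div_cancel₀ _ hs]
        linear_combination (p - q * Complex.I) * h1 j + (r - s * Complex.I) * h2 j - B 0 j * hc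
          + (-2*p*s*B 3 j + 2*q*r*B 3 j + 2*q*s*B 2 j + q^2*B 1 j + q^2*B 0 j
            - s^2*B 1 j + s^2*B 0 j) * hI
      · linear_combination Complex.I * ((p + q * Complex.I) * h2 j - (r + s * Complex.I) * h1 j)
          + (2*p*s*B 1 j - 2*p*q*B 2 j + 2*p*q*B 3 j*(Complex.I) + p^2*B 3 j + 2*s*q*B 1 j*(Complex.I)
            + 2*s*r*B 2 j + 2*s*r*B 3 j*(Complex.I) + s^2*B 2 j*(Complex.I) + s^2*B 3 j*(Complex.I^2-1)
            + 2*q*r*B 1 j - q^2*B 2 j*(Complex.I) + q^2*B 3 j*(Complex.I^2-1) + r^2*B 3 j) * hI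
    · obtain ⟨m, p, q', r, s', hn1', hu, hv⟩ := nf_normalize u v h0
      obtain ⟨q, rfl⟩ : ∃ q, q' = -q := ⟨-q', by simp⟩
      obtain ⟨s, rfl⟩ : ∃ s, s' = -s := ⟨-s', by simp⟩
      have hn1 : p^2+q^2+r^2+s^2 = 1 := by linarith
      have hc : (p:ℂ)^2+q^2+r^2+s^2 = 1 := by exact_mod_cast hn1
      push_cast at hu hv
      have h1 : ∀ j, (p + -q * Complex.I) * (B 0 j + B 1 j) +
          (r + -s * Complex.I) * (B 2 j - Complex.I * B 3 j) = 0 := fun j => by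
        rw [← hu, ← hv]; linear_combination m * (hh j).1
      have h2 : ∀ j, (p + -q * Complex.I) * (B 2 j + Complex.I * B 3 j) +
          (r + -s * Complex.I) * (B 0 j - B 1 j) = 0 := fun j => by
        rw [← hu, ← hv]; linear_combination m * (hh j).2
      refine ⟨nfRot p q r s, fun j => B 0 j / (Real.sqrt 2 : ℂ),
        fun j => -((nfRot p q r s).map Complex.ofReal * B) 2 j, -1, Or.inr rfl,
        nfRot_orth p q r s hn1, nfRot_det p q r s hn1, by simp [nfRot], ?_⟩
      ext i j
      fin_cases i <;> simp [nfRot, Matrix.mul_apply, Fin.sum_univ_four]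
      · field_simp
      · rw [mul_div_cancel₀ _ hs]
        linear_combination (p + q * Complex.I) * h1 j + (r + s * Complex.I) * h2 j - B 0 j * hc
          + (-2*p*s*B 3 j + 2*q*r*B 3 j + 2*q*s*B 2 j + q^2*B 1 j + q^2*B 0 j
            - s^2*B 1 j + s^2*B 0 j) * hI
      · linear_combination -Complex.I * ((p - q * Complex.I) * h2 j - (r - s * Complex.I) * h1 j)
          + (2*p*s*B 1 j - 2*p*q*B 2 j + 2*p*q*B 3 j*(-Complex.I) + p^2*B 3 j + 2*s*q*B 1 j*(-Complex.I)
            + 2*s*r*B 2 j + 2*s*r*B 3 j*(-Complex.I) + s^2*B 2 j*(-Complex.I) + s^2*B 3 j*(Complex.I^2-1)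
            + 2*q*r*B 1 j - q^2*B 2 j*(-Complex.I) + q^2*B 3 j*(Complex.I^2-1) + r^2*B 3 j) * hI
end

section
/- Let n ≥ 1 and let B be a 4×n complex matrix with Bᵗ I_{1,3} B = 0. Then there exist vectors l₁, l₂ ∈ ℂ⁴ satisfying ⟨lᵢ, lⱼ⟩ = 0 for all i, j ∈ {1,2}, and vectors v₁, v₂ ∈ ℂⁿ, such that B = l₁·v₁ᵗ + l₂·v₂ᵗ (that is, the columns of B are spanned by at most two mutually orthogonal null vectors of ℂ⁴). -/
open Matrix

/-- Let `B` be a `4×n` complex matrix with `Bᵗ I₁,₃ B = 0`.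
Then there exist vectors `l₁, l₂ ∈ ℂ⁴` with `⟨lᵢ, lⱼ⟩ = 0` for all
`i, j ∈ {1,2}` (where `⟨x,y⟩ = xᵗ I₁,₃ y`), and vectors `v₁, v₂ ∈ ℂⁿ`, such
that `B = l₁·v₁ᵗ + l₂·v₂ᵗ`. -/
theorem isotropic_matrix_spanned_by_two_null_vectors (n : ℕ) (hn : 1 ≤ n)
    (B : Matrix (Fin 4) (Fin n) ℂ)
    (hB : Bᵀ * Matrix.diagonal ![(-1 : ℂ), 1, 1, 1] * B = 0) :
    ∃ (l₁ l₂ : Fin 4 → ℂ) (v₁ v₂ : Fin n → ℂ),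
      (l₁ ⬝ᵥ (Matrix.diagonal ![(-1 : ℂ), 1, 1, 1]).mulVec l₁ = 0) ∧
      (l₁ ⬝ᵥ (Matrix.diagonal ![(-1 : ℂ), 1, 1, 1]).mulVec l₂ = 0) ∧
      (l₂ ⬝ᵥ (Matrix.diagonal ![(-1 : ℂ), 1, 1, 1]).mulVec l₁ = 0) ∧
      (l₂ ⬝ᵥ (Matrix.diagonal ![(-1 : ℂ), 1, 1, 1]).mulVec l₂ = 0) ∧
      B = Matrix.vecMulVec l₁ v₁ + Matrix.vecMulVec l₂ v₂ := by
  have hdet : (Matrix.diagonal ![(-1 : ℂ), 1, 1, 1]).det ≠ 0 := by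
    simp [Matrix.det_diagonal, Fin.prod_univ_four]
  have hr := Matrix.rank_add_rank_le_card_of_mul_eq_zero hB
  rw [Matrix.rank_mul_eq_left_of_det_ne_zero _ _ hdet, Matrix.rank_transpose,
    Fintype.card_fin] at hr
  have hd : Module.finrank ℂ (LinearMap.range B.mulVecLin) ≤ 2 := by
    change B.rank ≤ 2
    omega
  let e := (Module.finBasis ℂ (LinearMap.range B.mulVecLin)).equivFun
  have hs : Function.Surjective
      (LinearMap.funLeft ℂ ℂ (Fin.castLE hd)) :=
    LinearMap.funLeft_surjective_of_injective ℂ ℂ _ (Fin.castLE_injective hd)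
  obtain ⟨g, hg⟩ : ∃ g : (Fin 2 → ℂ) →ₗ[ℂ] LinearMap.range B.mulVecLin,
      Function.Surjective g :=
    ⟨e.symm.toLinearMap ∘ₗ LinearMap.funLeft ℂ ℂ (Fin.castLE hd),
      e.symm.surjective.comp hs⟩
  have orth : ∀ x y : LinearMap.range B.mulVecLin,
      (x : Fin 4 → ℂ) ⬝ᵥ (Matrix.diagonal ![(-1 : ℂ), 1, 1, 1]).mulVec (y : Fin 4 → ℂ) = 0 := by
    rintro ⟨_, a, rfl⟩ ⟨_, b, rfl⟩
    simp only [Matrix.mulVecLin_apply]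
    rw [← Matrix.vecMul_transpose, ← Matrix.dotProduct_mulVec, Matrix.mulVec_mulVec,
      Matrix.mulVec_mulVec, hB, Matrix.zero_mulVec, dotProduct_zero]
  choose c hc using fun j : Fin n => hg ⟨B.mulVecLin (Pi.single j 1), LinearMap.mem_range_self _ _⟩
  refine ⟨g (Pi.single 0 1), g (Pi.single 1 1), fun j => c j 0, fun j => c j 1,
    orth _ _, orth _ _, orth _ _, orth _ _, ?_⟩
  ext i j
  have h1 : c j = c j 0 • Pi.single 0 1 + c j 1 • Pi.single 1 1 := by
    ext k
    fin_cases k <;> simp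
  have h2 := hc j
  rw [h1, map_add, map_smul, map_smul] at h2
  have h3 := congrFun (congrArg Subtype.val h2) i
  simp only [Submodule.coe_add, Submodule.coe_smul, Pi.add_apply, Pi.smul_apply, smul_eq_mul,
    Matrix.mulVecLin_apply, Matrix.mulVec_single_one, Matrix.col_apply] at h3
  rw [Matrix.add_apply, Matrix.vecMulVec_apply, Matrix.vecMulVec_apply, ← h3]
  ring
end

section
/- Let v ∈ ℂ⁴ be a nonzero null vector, i.e. v ≠ 0 and ⟨v,v⟩ = 0. Then there exist A ∈ SO⁺(1,3) and c ∈ ℂ such that A·v equals c·(1,-1,0,0)ᵗ, or c·(0,0,-1,i)ᵗ, or c·(0,0,-1,-i)ᵗ. -/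
open Matrix

set_option maxHeartbeats 1000000

/-- real Minkowski form -/
def minkQ (x y : Fin 4 → ℝ) : ℝ := -(x 0 * y 0) + x 1 * y 1 + x 2 * y 2 + x 3 * y 3

/-- membership in O(1,3) -/
def IsLor (A : Matrix (Fin 4) (Fin 4) ℝ) : Prop :=
  Aᵀ * Matrix.diagonal ![(-1 : ℝ), 1, 1, 1] * A = Matrix.diagonal ![(-1 : ℝ), 1, 1, 1]

lemma IsLor.mul {A B : Matrix (Fin 4) (Fin 4) ℝ} (hA : IsLor A) (hB : IsLor B) :
    IsLor (A * B) := by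
  unfold IsLor at *
  calc _ = Bᵀ * (Aᵀ * Matrix.diagonal ![(-1 : ℝ), 1, 1, 1] * A) * B := by
        simp only [Matrix.transpose_mul, Matrix.mul_assoc]
    _ = _ := by rw [hA, hB]

lemma isLor_one : IsLor 1 := by simp [IsLor]

lemma isLor_diag (d : Fin 4 → ℝ) (hd : ∀ i, d i * d i = 1) : IsLor (Matrix.diagonal d) := by
  unfold IsLor
  rw [Matrix.diagonal_transpose, Matrix.diagonal_mul_diagonal, Matrix.diagonal_mul_diagonal]
  congr 1
  funext i
  linear_combination (![(-1 : ℝ), 1, 1, 1] i) * hd i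

lemma IsLor.sq {A : Matrix (Fin 4) (Fin 4) ℝ} (hA : IsLor A) : 1 ≤ A 0 0 * A 0 0 := by
  have h := congrFun (congrFun hA 0) 0
  simp [Matrix.mul_apply, Fin.sum_univ_four, Matrix.diagonal_apply] at h
  nlinarith [sq_nonneg (A 1 0), sq_nonneg (A 2 0), sq_nonneg (A 3 0)]

lemma IsLor.det {A : Matrix (Fin 4) (Fin 4) ℝ} (hA : IsLor A) : A.det = 1 ∨ A.det = -1 := by
  have h := congrArg Matrix.det hA
  simp [Matrix.det_mul, Matrix.det_diagonal, Fin.prod_univ_four] at h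
  exact mul_self_eq_one_iff.mp h

/-- reflection lemma -/
lemma exists_refl (a t : Fin 4 → ℝ) (h : minkQ a a = minkQ t t)
    (hu : minkQ (a - t) (a - t) ≠ 0) :
    ∃ A, IsLor A ∧ A.mulVec a = t ∧ ∀ x, minkQ (a - t) x = 0 → A.mulVec x = x := by
  obtain ⟨u, hud⟩ : ∃ u, u = a - t := ⟨_, rfl⟩
  rw [← hud] at hu ⊢
  obtain ⟨k, hkd⟩ : ∃ k, k = 2 / minkQ u u := ⟨_, rfl⟩
  have hk : k * minkQ u u = 2 := by rw [hkd]; field_simp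
  let w : Fin 4 → ℝ := ![-u 0, u 1, u 2, u 3]
  have hw : ∀ x, w ⬝ᵥ x = minkQ u x := by
    intro x
    simp [w, dotProduct, Fin.sum_univ_four, minkQ]
  have hmv : ∀ x, (1 - k • Matrix.vecMulVec u w).mulVec x = x - (k * minkQ u x) • u := by
    intro x
    rw [Matrix.sub_mulVec, Matrix.one_mulVec, Matrix.smul_mulVec, Matrix.vecMulVec_mulVec, hw]
    ext i
    simp
    ring
  refine ⟨1 - k • Matrix.vecMulVec u w, ?_, ?_, ?_⟩
  · unfold IsLor
    unfold minkQ at hk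
    ext i j
    have key := hk
    fin_cases i <;> fin_cases j <;>
      simp [Matrix.mul_apply, Fin.sum_univ_four, Matrix.diagonal_apply, Matrix.vecMulVec_apply,
        Matrix.one_apply, w]
    · linear_combination (k * u 0 * u 0) * hk
    · linear_combination (-k * u 0 * u 1) * hk
    · linear_combination (-k * u 0 * u 2) * hk
    · linear_combination (-k * u 0 * u 3) * hk
    · linear_combination (-k * u 1 * u 0) * hk
    · linear_combination (k * u 1 * u 1) * hk
    · linear_combination (k * u 1 * u 2) * hk
    · linear_combination (k * u 1 * u 3) * hk
    · linear_combination (-k * u 2 * u 0) * hk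
    · linear_combination (k * u 2 * u 1) * hk
    · linear_combination (k * u 2 * u 2) * hk
    · linear_combination (k * u 2 * u 3) * hk
    · linear_combination (-k * u 3 * u 0) * hk
    · linear_combination (k * u 3 * u 1) * hk
    · linear_combination (k * u 3 * u 2) * hk
    · linear_combination (k * u 3 * u 3) * hk
  · rw [hmv]
    have h2 : k * minkQ u a = 1 := by
      have : minkQ u u = 2 * minkQ u a := by
        subst hud
        simp [minkQ] at h ⊢
        linear_combination -h
      linear_combination hk / 2 - k / 2 * this
    rw [h2, hud]; simp
  · intro x hx
    rw [hmv, hx]; simp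

lemma IsLor.pres {A : Matrix (Fin 4) (Fin 4) ℝ} (hA : IsLor A) (x y : Fin 4 → ℝ) :
    minkQ (A.mulVec x) (A.mulVec y) = minkQ x y := by
  have e : ∀ x y : Fin 4 → ℝ,
      minkQ x y = x ⬝ᵥ (Matrix.diagonal ![(-1 : ℝ), 1, 1, 1]).mulVec y := by
    intro x y
    simp [minkQ, dotProduct, Fin.sum_univ_four, Matrix.mulVec_diagonal]
  rw [e, e]
  conv_rhs => rw [← hA]
  rw [← Matrix.mulVec_mulVec, ← Matrix.mulVec_mulVec, Matrix.dotProduct_mulVec x,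
    Matrix.vecMul_transpose]

/-- move a spacelike vector to `± t`. -/
lemma exists_refl_pm (a t : Fin 4 → ℝ) (h : minkQ a a = minkQ t t) (ht : 0 < minkQ t t) :
    ∃ A, IsLor A ∧ (A.mulVec a = t ∨ A.mulVec a = -t) ∧
      ∀ x, minkQ a x = 0 → minkQ t x = 0 → A.mulVec x = x := by
  by_cases h1 : minkQ (a - t) (a - t) = 0
  · have h2 : minkQ (a - (-t)) (a - (-t)) ≠ 0 := by
      intro h2
      simp [minkQ] at *
      nlinarith
    obtain ⟨A, hA, hAa, hf⟩ := exists_refl a (-t) (by rw [h]; simp [minkQ]) h2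
    refine ⟨A, hA, Or.inr hAa, fun x hx hy => hf x ?_⟩
    simp [minkQ] at *
    linarith
  · obtain ⟨A, hA, hAa, hf⟩ := exists_refl a t h h1
    refine ⟨A, hA, Or.inl hAa, fun x hx hy => hf x ?_⟩
    simp [minkQ] at *
    linarith

lemma map_mulVec_eq (A : Matrix (Fin 4) (Fin 4) ℝ) (v : Fin 4 → ℂ) :
    (A.map Complex.ofReal).mulVec v = fun i =>
      ((A.mulVec (fun j => (v j).re) i : ℝ) : ℂ)
        + ((A.mulVec (fun j => (v j).im) i : ℝ) : ℂ) * Complex.I := by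
  funext i
  apply Complex.ext <;> simp [Matrix.mulVec, dotProduct, Fin.sum_univ_four]

/-- fix determinant and time orientation by a diagonal sign matrix -/
lemma finish {A : Matrix (Fin 4) (Fin 4) ℝ} (hA : IsLor A) (d : Fin 4 → ℝ)
    (hd : ∀ i, d i * d i = 1) (h0 : d 0 * A 0 0 > 0)
    (hdet : d 0 * d 1 * d 2 * d 3 * A.det = 1) :
    Matrix.IsDiag (Matrix.diagonal d) ∧ IsLor (Matrix.diagonal d * A) ∧
      (Matrix.diagonal d * A).det = 1 ∧ 0 < (Matrix.diagonal d * A) 0 0 ∧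
      ∀ v : Fin 4 → ℂ, ((Matrix.diagonal d * A).map Complex.ofReal).mulVec v =
        fun i => (d i : ℂ) * (A.map Complex.ofReal).mulVec v i := by
  refine ⟨Matrix.isDiag_diagonal d, (isLor_diag d hd).mul hA, ?_, ?_, ?_⟩
  · rw [Matrix.det_mul, Matrix.det_diagonal, Fin.prod_univ_four, hdet]
  · rw [Matrix.diagonal_mul]; exact h0
  · intro v
    funext i
    simp only [Matrix.mulVec, dotProduct, Matrix.map_apply, Matrix.diagonal_mul, Finset.mul_sum]
    refine Finset.sum_congr rfl fun j _ => ?_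
    push_cast
    ring

lemma exists_sign (x : ℝ) (hx : 1 ≤ x * x) : ∃ e : ℝ, e * e = 1 ∧ e * x > 0 := by
  rcases lt_trichotomy x 0 with h | h | h
  · exact ⟨-1, by norm_num, by linarith⟩
  · subst h; norm_num at hx
  · exact ⟨1, by norm_num, by linarith⟩

lemma exists_dsign {A : Matrix (Fin 4) (Fin 4) ℝ} (hA : IsLor A) :
    ∃ e : ℝ, e * e = 1 ∧ e * A.det = 1 := by
  rcases hA.det with h | h
  · exact ⟨1, by norm_num, by rw [h]; norm_num⟩
  · exact ⟨-1, by norm_num, by rw [h]; norm_num⟩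

/-- Let `v ∈ ℂ⁴` be a nonzero null vector (for the complex
bilinear extension of the Minkowski form).  Then there exist `A ∈ SO⁺(1,3)`
and `c ∈ ℂ` such that `A·v` equals `c·(1,-1,0,0)ᵗ`, or `c·(0,0,-1,i)ᵗ`, or
`c·(0,0,-1,-i)ᵗ`. -/
theorem null_vector_normal_form (v : Fin 4 → ℂ) (hv : v ≠ 0)
    (hnull : v ⬝ᵥ (Matrix.diagonal ![(-1 : ℂ), 1, 1, 1]).mulVec v = 0) :
    ∃ (A : Matrix (Fin 4) (Fin 4) ℝ) (c : ℂ),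
      Aᵀ * Matrix.diagonal ![(-1 : ℝ), 1, 1, 1] * A
          = Matrix.diagonal ![(-1 : ℝ), 1, 1, 1] ∧
      A.det = 1 ∧ 0 < A 0 0 ∧
      ((A.map Complex.ofReal).mulVec v = c • ![1, -1, 0, 0] ∨
        (A.map Complex.ofReal).mulVec v = c • ![0, 0, -1, Complex.I] ∨
        (A.map Complex.ofReal).mulVec v = c • ![0, 0, -1, -Complex.I]) := by
  obtain ⟨a, ha⟩ : ∃ a : Fin 4 → ℝ, a = fun j => (v j).re := ⟨_, rfl⟩
  obtain ⟨b, hb⟩ : ∃ b : Fin 4 → ℝ, b = fun j => (v j).im := ⟨_, rfl⟩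
  have hvab : ∀ i, v i = (a i : ℂ) + (b i : ℂ) * Complex.I := by
    intro i; rw [ha, hb]; simp
  have hn : minkQ a a = minkQ b b ∧ minkQ a b = 0 := by
    simp only [dotProduct, Fin.sum_univ_four, Matrix.mulVec_diagonal] at hnull
    have h1 := congrArg Complex.re hnull
    have h2 := congrArg Complex.im hnull
    simp at h1 h2
    subst ha hb
    constructor <;> simp only [minkQ] <;> linarith
  obtain ⟨hab, hortho⟩ := hn
  rcases lt_trichotomy (minkQ b b) 0 with hs | hs | hs
  · exfalso
    have hsa : minkQ a a < 0 := by rw [hab]; exact hs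
    simp only [minkQ] at hs hsa hortho
    have h1 : (a 1 * a 1 + a 2 * a 2 + a 3 * a 3) * (b 1 * b 1 + b 2 * b 2 + b 3 * b 3)
        < (a 0 * a 0) * (b 0 * b 0) := by
      apply mul_lt_mul'' <;> nlinarith [sq_nonneg (a 1), sq_nonneg (a 2), sq_nonneg (a 3),
        sq_nonneg (b 1), sq_nonneg (b 2), sq_nonneg (b 3)]
    have h2 : a 0 * b 0 = a 1 * b 1 + a 2 * b 2 + a 3 * b 3 := by linarith
    have h3 : (a 0 * a 0) * (b 0 * b 0)
        = (a 1 * b 1 + a 2 * b 2 + a 3 * b 3) * (a 1 * b 1 + a 2 * b 2 + a 3 * b 3) := by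
      rw [← h2]; ring
    nlinarith [sq_nonneg (a 1 * b 2 - a 2 * b 1), sq_nonneg (a 1 * b 3 - a 3 * b 1),
      sq_nonneg (a 2 * b 3 - a 3 * b 2)]
  · -- null case
    have hsa : minkQ a a = 0 := by rw [hab, hs]
    have hcross : (b 0 * a 1 - a 0 * b 1) ^ 2 + (b 0 * a 2 - a 0 * b 2) ^ 2
        + (b 0 * a 3 - a 0 * b 3) ^ 2 = 0 := by
      simp only [minkQ] at hs hsa hortho
      linear_combination (b 0) ^ 2 * hsa + (a 0) ^ 2 * hs - 2 * a 0 * b 0 * hortho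
    have c1 : b 0 * a 1 - a 0 * b 1 = 0 := by
      apply pow_eq_zero_iff (two_ne_zero) |>.mp
      linarith [sq_nonneg (b 0 * a 1 - a 0 * b 1), sq_nonneg (b 0 * a 2 - a 0 * b 2), sq_nonneg (b 0 * a 3 - a 0 * b 3)]
    have c2 : b 0 * a 2 - a 0 * b 2 = 0 := by
      apply pow_eq_zero_iff (two_ne_zero) |>.mp
      linarith [sq_nonneg (b 0 * a 1 - a 0 * b 1), sq_nonneg (b 0 * a 2 - a 0 * b 2), sq_nonneg (b 0 * a 3 - a 0 * b 3)]
    have c3 : b 0 * a 3 - a 0 * b 3 = 0 := by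
      apply pow_eq_zero_iff (two_ne_zero) |>.mp
      linarith [sq_nonneg (b 0 * a 1 - a 0 * b 1), sq_nonneg (b 0 * a 2 - a 0 * b 2), sq_nonneg (b 0 * a 3 - a 0 * b 3)]
    have hzero : ∀ x : Fin 4 → ℝ, minkQ x x = 0 → x 0 = 0 → ∀ i, x i = 0 := by
      intro x hx h0
      simp only [minkQ] at hx
      rw [h0] at hx
      have h1 : x 1 = 0 := by
        apply pow_eq_zero_iff (two_ne_zero) |>.mp
        linarith [sq (x 1), sq (x 2), sq (x 3), sq_nonneg (x 1), sq_nonneg (x 2), sq_nonneg (x 3)]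
      have h2 : x 2 = 0 := by
        apply pow_eq_zero_iff (two_ne_zero) |>.mp
        linarith [sq (x 1), sq (x 2), sq (x 3), sq_nonneg (x 1), sq_nonneg (x 2), sq_nonneg (x 3)]
      have h3 : x 3 = 0 := by
        apply pow_eq_zero_iff (two_ne_zero) |>.mp
        linarith [sq (x 1), sq (x 2), sq (x 3), sq_nonneg (x 1), sq_nonneg (x 2), sq_nonneg (x 3)]
      intro i; fin_cases i <;> assumption
    have hr : 0 < a 0 * a 0 + b 0 * b 0 := by
      by_contra hcon
      have h1 : a 0 = 0 := by
        apply mul_self_eq_zero.mp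
        linarith [mul_self_nonneg (a 0), mul_self_nonneg (b 0)]
      have h2 : b 0 = 0 := by
        apply mul_self_eq_zero.mp
        linarith [mul_self_nonneg (a 0), mul_self_nonneg (b 0)]
      apply hv
      funext i
      rw [hvab, hzero a hsa h1, hzero b hs h2]; simp
    obtain ⟨r, hrd⟩ : ∃ r, r = a 0 * a 0 + b 0 * b 0 := ⟨_, rfl⟩
    rw [← hrd] at hr
    obtain ⟨n, hnd⟩ : ∃ n : Fin 4 → ℝ, n = fun i => (a 0 * a i + b 0 * b i) / r := ⟨_, rfl⟩
    have cc : ∀ i, b 0 * a i = a 0 * b i := by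
      intro i
      fin_cases i <;> simp <;> linarith
    have hna : a = (a 0) • n := by
      funext i
      simp [hnd]
      field_simp
      rw [hrd]
      linear_combination (b 0) * cc i
    have hnb : b = (b 0) • n := by
      funext i
      simp [hnd]
      field_simp
      rw [hrd]
      linear_combination (-a 0) * cc i
    have hn0 : n 0 = 1 := by rw [hnd]; simp [← hrd, hr.ne']
    have hnn : minkQ n n = 0 := by
      have h1 : minkQ a a = a 0 * a 0 * minkQ n n := by
        conv_lhs => rw [hna]
        simp [minkQ]; ring
      have h2 : minkQ b b = b 0 * b 0 * minkQ n n := by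
        conv_lhs => rw [hnb]
        simp [minkQ]; ring
      have h3 : r * minkQ n n = 0 := by rw [hrd]; linarith
      rcases mul_eq_zero.mp h3 with h | h
      · exact absurd h hr.ne'
      · exact h
    have hex : ∃ A, IsLor A ∧ A.mulVec n = ![1, -1, 0, 0] := by
      by_cases hq : minkQ (n - ![1, -1, 0, 0]) (n - ![1, -1, 0, 0]) = 0
      · refine ⟨1, isLor_one, ?_⟩
        rw [Matrix.one_mulVec]
        have := hzero _ hq (by simp [hn0])
        funext i
        exact sub_eq_zero.mp (this i)
      · obtain ⟨A, hA, h, _⟩ := exists_refl n ![1, -1, 0, 0] (by rw [hnn]; simp [minkQ]) hq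
        exact ⟨A, hA, h⟩
    obtain ⟨A, hA, hAn⟩ := hex
    obtain ⟨e, he, he0⟩ := exists_sign (A 0 0) hA.sq
    obtain ⟨f, hf, hfdet⟩ := exists_dsign hA
    obtain ⟨-, k1, k2, k3, k4⟩ := finish hA ![e, e, e, e * f]
      (by intro i; fin_cases i <;> simp [he]; linear_combination f * f * he + hf)
      (by simpa using he0)
      (by simp; linear_combination (e * e + 1) * f * A.det * he + hfdet)
    refine ⟨_, (e : ℂ) * v 0, k1, k2, k3, Or.inl ?_⟩
    rw [k4, map_mulVec_eq, ← ha, ← hb, hna, hnb, Matrix.mulVec_smul, Matrix.mulVec_smul, hAn,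
      hvab 0]
    funext i
    fin_cases i <;> simp
    ring
  · -- spacelike case
    obtain ⟨s, hsd⟩ : ∃ s, s = Real.sqrt (minkQ b b) := ⟨_, rfl⟩
    have hs2 : s * s = minkQ b b := by rw [hsd]; exact Real.mul_self_sqrt hs.le
    have hs0 : s ≠ 0 := by rintro rfl; linarith
    have ht2 : minkQ ![0, 0, s, 0] ![0, 0, s, 0] = s * s := by simp [minkQ]
    have ht3 : minkQ ![0, 0, 0, s] ![0, 0, 0, s] = s * s := by simp [minkQ]
    obtain ⟨A, hA, hAa, -⟩ := exists_refl_pm a ![0, 0, s, 0] (by rw [ht2, hs2, hab])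
      (by rw [ht2, hs2]; exact hs)
    have hb2 : minkQ (A.mulVec b) ![0, 0, s, 0] = 0 := by
      have := hA.pres a b
      rw [hortho] at this
      rcases hAa with h | h <;> rw [h] at this <;> simp [minkQ] at this ⊢ <;>
      · rcases this with h | h <;> simp [h]
    obtain ⟨B, hB, hBb, hBf⟩ := exists_refl_pm (A.mulVec b) ![0, 0, 0, s]
      (by rw [ht3, hs2, hA.pres]) (by rw [ht3, hs2]; exact hs)
    have hfix := hBf _ hb2 (by simp [minkQ])
    have hBA := hB.mul hA
    have e1 : (B * A).mulVec a = ![0, 0, s, 0] ∨ (B * A).mulVec a = -![0, 0, s, 0] := by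
      rw [← Matrix.mulVec_mulVec]
      rcases hAa with h | h <;> rw [h]
      · exact Or.inl hfix
      · right; rw [Matrix.mulVec_neg, hfix]
    have e2 : (B * A).mulVec b = ![0, 0, 0, s] ∨ (B * A).mulVec b = -![0, 0, 0, s] := by
      rw [← Matrix.mulVec_mulVec]; exact hBb
    generalize B * A = C at hBA e1 e2
    obtain ⟨e, he, he0⟩ := exists_sign (C 0 0) hBA.sq
    obtain ⟨f, hf, hfdet⟩ := exists_dsign hBA
    obtain ⟨-, k1, k2, k3, k4⟩ := finish hBA ![e, e * f, 1, 1]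
      (by intro i; fin_cases i <;> simp [he]; linear_combination f * f * he + hf)
      (by simpa using he0)
      (by simp; linear_combination f * C.det * he + hfdet)
    rcases e1 with e1 | e1 <;> rcases e2 with e2 | e2
    · refine ⟨_, -(s : ℂ), k1, k2, k3, Or.inr (Or.inr ?_)⟩
      rw [k4, map_mulVec_eq, ← ha, ← hb, e1, e2]
      funext i
      fin_cases i <;> simp
    · refine ⟨_, -(s : ℂ), k1, k2, k3, Or.inr (Or.inl ?_)⟩
      rw [k4, map_mulVec_eq, ← ha, ← hb, e1, e2]
      funext i
      fin_cases i <;> simp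
    · refine ⟨_, (s : ℂ), k1, k2, k3, Or.inr (Or.inl ?_)⟩
      rw [k4, map_mulVec_eq, ← ha, ← hb, e1, e2]
      funext i
      fin_cases i <;> simp
    · refine ⟨_, (s : ℂ), k1, k2, k3, Or.inr (Or.inr ?_)⟩
      rw [k4, map_mulVec_eq, ← ha, ← hb, e1, e2]
      funext i
      fin_cases i <;> simp
end

section
/- Let n ≥ 1 and let a₁₂, a₁₃, a₁₄, a₂₃, a₂₄, a₃₄ ∈ ℂ, (b_{lj})_{1≤l,j≤n} ⊆ ℂ, and β, k, β′, k′ ∈ ℂⁿ satisfy, for every j ∈ {1,…,n}: (i) β′_j - conj(a₁₂)β_j - (√2/2)(conj(a₁₃)+i·conj(a₁₄))k_j - Σ_l β_l·conj(b_{lj}) = 0; (ii) -β′_j + conj(a₁₂)β_j - (√2/2)(conj(a₂₃)+i·conj(a₂₄))k_j + Σ_l β_l·conj(b_{lj}) = 0; (iii) -k′_j + √2(conj(a₁₃)+conj(a₂₃))β_j - i·conj(a₃₄)k_j + Σ_l k_l·conj(b_{lj}) = 0; (iv) -i·k′_j + √2(conj(a₁₄)+conj(a₂₄))β_j + conj(a₃₄)k_j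 + i·Σ_l k_l·conj(b_{lj}) = 0. If k_j ≠ 0 for some j, or β_j ≠ 0 for some j, then a₁₃ + a₂₃ = i(a₁₄ + a₂₄). -/
open Complex Finset

/-- The pointwise algebraic consequence of the harmonic map
equations: if the four families of equations (i)–(iv) hold and `k` or `β` does
not vanish identically, then `a₁₃ + a₂₃ = i(a₁₄ + a₂₄)`. -/
theorem harmonic_equations_force_relation (n : ℕ) (hn : 1 ≤ n)
    (a₁₂ a₁₃ a₁₄ a₂₃ a₂₄ a₃₄ : ℂ) (b : Fin n → Fin n → ℂ)
    (β k β' k' : Fin n → ℂ)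
    (h1 : ∀ j, β' j - (starRingEnd ℂ) a₁₂ * β j
        - (Real.sqrt 2 : ℂ) / 2 * ((starRingEnd ℂ) a₁₃ + I * (starRingEnd ℂ) a₁₄) * k j
        - ∑ l, β l * (starRingEnd ℂ) (b l j) = 0)
    (h2 : ∀ j, -β' j + (starRingEnd ℂ) a₁₂ * β j
        - (Real.sqrt 2 : ℂ) / 2 * ((starRingEnd ℂ) a₂₃ + I * (starRingEnd ℂ) a₂₄) * k j
        + ∑ l, β l * (starRingEnd ℂ) (b l j) = 0)
    (h3 : ∀ j, -k' j
        + (Real.sqrt 2 : ℂ) * ((starRingEnd ℂ) a₁₃ + (starRingEnd ℂ) a₂₃) * β j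
        - I * (starRingEnd ℂ) a₃₄ * k j
        + ∑ l, k l * (starRingEnd ℂ) (b l j) = 0)
    (h4 : ∀ j, -I * k' j
        + (Real.sqrt 2 : ℂ) * ((starRingEnd ℂ) a₁₄ + (starRingEnd ℂ) a₂₄) * β j
        + (starRingEnd ℂ) a₃₄ * k j
        + I * ∑ l, k l * (starRingEnd ℂ) (b l j) = 0)
    (hne : (∃ j, k j ≠ 0) ∨ (∃ j, β j ≠ 0)) :
    a₁₃ + a₂₃ = I * (a₁₄ + a₂₄) := by
  have hs : (Real.sqrt 2 : ℂ) ≠ 0 := by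
    have h : Real.sqrt 2 ≠ 0 := by positivity
    exact_mod_cast h
  have key : ((starRingEnd ℂ) a₁₃ + (starRingEnd ℂ) a₂₃)
      + I * ((starRingEnd ℂ) a₁₄ + (starRingEnd ℂ) a₂₄) = 0 := by
    rcases hne with ⟨j, hj⟩ | ⟨j, hj⟩
    · have h : ((Real.sqrt 2 : ℂ) * k j) * (((starRingEnd ℂ) a₁₃ + (starRingEnd ℂ) a₂₃)
          + I * ((starRingEnd ℂ) a₁₄ + (starRingEnd ℂ) a₂₄)) = 0 := by
        linear_combination (-2) * h1 j + (-2) * h2 j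
      exact (mul_eq_zero.mp h).resolve_left (mul_ne_zero hs hj)
    · have h : ((Real.sqrt 2 : ℂ) * β j) * (((starRingEnd ℂ) a₁₃ + (starRingEnd ℂ) a₂₃)
          + I * ((starRingEnd ℂ) a₁₄ + (starRingEnd ℂ) a₂₄)) = 0 := by
        linear_combination h3 j + I * h4 j
          + (k' j - ∑ l, k l * (starRingEnd ℂ) (b l j)) * I_mul_I
      exact (mul_eq_zero.mp h).resolve_left (mul_ne_zero hs hj)
  have h := congrArg (starRingEnd ℂ) key
  simp only [map_add, map_mul, conj_conj, conj_I, map_zero] at h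
  linear_combination h
end
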